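/- For any τ in the upper half-plane with q = exp(πiτ), and every complex number z, the Jacobi infinite product expression θ₂(z|τ) = 2 q^{1/4} cos z · (q²;q²)_∞ · (−q² e^{2iz};q²)_∞ · (−q² e^{−2iz};q²)_∞ holds. -/

import Mathlib

open Complex

/-- Jacobi theta function θ₁(z|τ) with nome q = exp(πiτ). -/
noncomputable def theta1 (z τ : ℂ) : ℂ :=
  -I * exp ((Real.pi : ℂ) * I * τ / 4) *
    ∑' k : ℤ, (-1 : ℂ) ^ k * exp ((Real.pi : ℂ) * I * τ * ((k : ℂ) * ((k : ℂ) + 1))) *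
      exp ((2 * (k : ℂ) + 1) * z * I)

/-- Jacobi theta function θ₂(z|τ) with nome q = exp(πiτ). -/
noncomputable def theta2 (z τ : ℂ) : ℂ :=
  exp ((Real.pi : ℂ) * I * τ / 4) *
    ∑' k : ℤ, exp ((Real.pi : ℂ) * I * τ * ((k : ℂ) * ((k : ℂ) + 1))) *
      exp ((2 * (k : ℂ) + 1) * z * I)

/-- Jacobi theta function θ₃(z|τ) with nome q = exp(πiτ). -/
noncomputable def theta3 (z τ : ℂ) : ℂ :=
  ∑' k : ℤ, exp ((Real.pi : ℂ) * I * τ * ((k : ℂ) ^ 2)) * exp (2 * (k : ℂ) * z * I)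

/-- Jacobi theta function θ₄(z|τ) with nome q = exp(πiτ). -/
noncomputable def theta4 (z τ : ℂ) : ℂ :=
  ∑' k : ℤ, (-1 : ℂ) ^ k * exp ((Real.pi : ℂ) * I * τ * ((k : ℂ) ^ 2)) * exp (2 * (k : ℂ) * z * I)

/-- The q-shifted factorial (a;q)_∞ = ∏_{n≥0} (1 - a qⁿ). -/
noncomputable def qpoch (a q : ℂ) : ℂ := ∏' n : ℕ, (1 - a * q ^ n)

open Filter Topology Finset

/-- Gaussian binomial coefficients, defined by the `q`-Pascal recursion. -/
def gaussBinom (q : ℂ) : ℕ → ℕ → ℂ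
  | _, 0 => 1
  | 0, _ + 1 => 0
  | n + 1, k + 1 => q ^ (k + 1) * gaussBinom q n (k + 1) + gaussBinom q n k

lemma gaussBinom_zero_right (q : ℂ) (n : ℕ) : gaussBinom q n 0 = 1 := by
  cases n <;> simp [gaussBinom]

lemma gaussBinom_eq_zero_of_lt (q : ℂ) {n k : ℕ} (h : n < k) : gaussBinom q n k = 0 := by
  induction n generalizing k with
  | zero =>
    obtain ⟨k, rfl⟩ := Nat.exists_eq_succ_of_ne_zero h.ne'
    rfl
  | succ n ih =>
    obtain ⟨k, rfl⟩ := Nat.exists_eq_succ_of_ne_zero (Nat.ne_zero_of_lt h)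
    simp [gaussBinom, ih (show n < k + 1 by omega), ih (show n < k by omega)]

/-- The `q`-binomial theorem. -/
lemma prod_one_add_mul_pow_eq_sum_gaussBinom (q y : ℂ) (n : ℕ) :
    ∏ i ∈ range n, (1 + y * q ^ (2 * i + 1)) =
      ∑ j ∈ range (n + 1), gaussBinom (q ^ 2) n j * q ^ (j ^ 2) * y ^ j := by
  induction n generalizing y with
  | zero => simp [gaussBinom]
  | succ n ih =>
    have hprod : ∏ i ∈ range n, (1 + y * q ^ (2 * (i + 1) + 1)) =
        ∏ i ∈ range n, (1 + (y * q ^ 2) * q ^ (2 * i + 1)) :=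
      prod_congr rfl fun i _ ↦ by ring
    have hlast : ∑ j ∈ range (n + 1), gaussBinom (q ^ 2) n j * q ^ (j ^ 2) * (y * q ^ 2) ^ j =
        1 + ∑ j ∈ range (n + 1),
          gaussBinom (q ^ 2) n (j + 1) * q ^ ((j + 1) ^ 2) * (y * q ^ 2) ^ (j + 1) := by
      have h := sum_range_succ
        (fun j ↦ gaussBinom (q ^ 2) n j * q ^ (j ^ 2) * (y * q ^ 2) ^ j) (n + 1)
      rw [gaussBinom_eq_zero_of_lt _ (Nat.lt_succ_self n), zero_mul, zero_mul, add_zero] at h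
      rw [← h, sum_range_succ', gaussBinom_zero_right]
      ring
    rw [prod_range_succ', hprod, ih, mul_add, sum_range_succ' _ (n + 1), gaussBinom_zero_right,
      mul_one]
    nth_rewrite 1 [hlast]
    have hpascal : ∑ j ∈ range (n + 1),
          gaussBinom (q ^ 2) n (j + 1) * q ^ ((j + 1) ^ 2) * (y * q ^ 2) ^ (j + 1) +
        (∑ j ∈ range (n + 1), gaussBinom (q ^ 2) n j * q ^ (j ^ 2) * (y * q ^ 2) ^ j) *
          (y * q ^ (2 * 0 + 1)) =
        ∑ j ∈ range (n + 1), gaussBinom (q ^ 2) (n + 1) (j + 1) * q ^ ((j + 1) ^ 2) *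
          y ^ (j + 1) := by
      rw [sum_mul, ← sum_add_distrib]
      refine sum_congr rfl fun j _ ↦ ?_
      simp only [gaussBinom]
      ring
    rw [add_assoc, hpascal]
    ring

/-- The finite `q`-factorial `(q;q)_n`. -/
def qfac (q : ℂ) (n : ℕ) : ℂ := ∏ i ∈ range n, (1 - q * q ^ i)

lemma gaussBinom_add_mul (q : ℂ) (a b : ℕ) :
    gaussBinom q (a + b) a * (qfac q a * qfac q b) = qfac q (a + b) := by
  induction h : a + b generalizing a b with
  | zero =>
    obtain ⟨rfl, rfl⟩ : a = 0 ∧ b = 0 := by omega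
    simp [gaussBinom, qfac]
  | succ n ih =>
    rcases a with _ | a
    · obtain rfl : b = n + 1 := by omega
      simp [gaussBinom, qfac]
    have h1 := ih a b (by omega)
    have hn : qfac q (n + 1) = qfac q n * (1 - q * q ^ n) := prod_range_succ _ _
    have ha : qfac q (a + 1) = qfac q a * (1 - q * q ^ a) := prod_range_succ _ _
    rcases b with _ | b
    · obtain rfl : n = a := by omega
      rw [gaussBinom, gaussBinom_eq_zero_of_lt _ (Nat.lt_succ_self n), hn]
      linear_combination (1 - q * q ^ n) * h1
    · have h2 := ih (a + 1) b (by omega)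
      have hb : qfac q (b + 1) = qfac q b * (1 - q * q ^ b) := prod_range_succ _ _
      have hab : n = a + b + 1 := by omega
      calc gaussBinom q (n + 1) (a + 1) * (qfac q (a + 1) * qfac q (b + 1))
          = q ^ (a + 1) * (1 - q * q ^ b) *
              (gaussBinom q n (a + 1) * (qfac q (a + 1) * qfac q b)) +
            (1 - q * q ^ a) * (gaussBinom q n a * (qfac q a * qfac q (b + 1))) := by
              rw [gaussBinom, ha, hb]; ring
        _ = qfac q (n + 1) := by rw [h1, h2, hn, hab]; ring

lemma multipliable_qpoch {q : ℂ} (hq : ‖q‖ < 1) (a : ℂ) :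
    Multipliable fun n : ℕ ↦ 1 - a * q ^ n := by
  apply multipliable_one_add_of_summable (f := fun n ↦ -(a * q ^ n))
  simpa using (summable_geometric_of_lt_one (norm_nonneg _) hq).mul_left ‖a‖

lemma tendsto_prod_qpoch {q : ℂ} (hq : ‖q‖ < 1) (a : ℂ) :
    Tendsto (fun n ↦ ∏ i ∈ range n, (1 - a * q ^ i)) atTop (𝓝 (qpoch a q)) :=
  (multipliable_qpoch hq a).hasProd.tendsto_prod_nat

lemma qpoch_eq_one_sub_mul {q : ℂ} (hq : ‖q‖ < 1) (a : ℂ) :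
    qpoch a q = (1 - a) * qpoch (a * q) q := by
  have h : Tendsto (fun n ↦ ∏ i ∈ range (n + 1), (1 - a * q ^ i)) atTop
      (𝓝 ((1 - a) * qpoch (a * q) q)) := by
    refine ((tendsto_prod_qpoch hq (a * q)).const_mul (1 - a)).congr fun n ↦ ?_
    rw [prod_range_succ', pow_zero, mul_one, mul_comm]
    congr 1
    exact prod_congr rfl fun i _ ↦ by ring
  exact tendsto_nhds_unique ((tendsto_prod_qpoch hq a).comp (tendsto_add_atTop_nat 1)) h

lemma one_sub_mul_pow_ne_zero {q : ℂ} (hq : ‖q‖ < 1) (n : ℕ) : 1 - q * q ^ n ≠ 0 := by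
  rw [← pow_succ', sub_ne_zero]
  intro h
  have := pow_lt_one₀ (norm_nonneg q) hq n.succ_ne_zero
  rw [← norm_pow, ← h, norm_one] at this
  exact lt_irrefl _ this

lemma qfac_ne_zero {q : ℂ} (hq : ‖q‖ < 1) (n : ℕ) : qfac q n ≠ 0 :=
  prod_ne_zero_iff.mpr fun i _ ↦ one_sub_mul_pow_ne_zero hq i

lemma qpoch_self_ne_zero {q : ℂ} (hq : ‖q‖ < 1) : qpoch q q ≠ 0 := by
  refine tprod_one_add_ne_zero_of_summable (f := fun n ↦ -(q * q ^ n)) ?_ ?_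
  · intro n
    simpa [sub_eq_add_neg] using one_sub_mul_pow_ne_zero hq n
  · simpa using (summable_geometric_of_lt_one (norm_nonneg _) hq).mul_left ‖q‖

/-- The central Gaussian coefficient `[2n, n + k]` expressed through `q`-factorials, extended by
zero to all integers `k`. -/
noncomputable def centralCoeff (q : ℂ) (n : ℕ) (k : ℤ) : ℂ :=
  if k ∈ Icc (-n : ℤ) n then qfac q (2 * n) / (qfac q (n + k).toNat * qfac q (n - k).toNat) else 0

lemma tendsto_centralCoeff {q : ℂ} (hq : ‖q‖ < 1) (k : ℤ) :
    Tendsto (fun n ↦ centralCoeff q n k) atTop (𝓝 (qpoch q q)⁻¹) := by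
  have hne := qpoch_self_ne_zero hq
  have hlim : Tendsto (qfac q) atTop (𝓝 (qpoch q q)) := tendsto_prod_qpoch hq q
  have h0 : Tendsto (fun n : ℕ ↦ 2 * n) atTop atTop :=
    tendsto_atTop_mono (fun n ↦ Nat.le_mul_of_pos_left n two_pos) tendsto_id
  have h1 : Tendsto (fun n : ℕ ↦ ((n : ℤ) + k).toNat) atTop atTop :=
    tendsto_atTop_mono (f := fun n : ℕ ↦ n - k.natAbs) (fun n ↦ by omega)
      (tendsto_sub_atTop_nat _)
  have h2 : Tendsto (fun n : ℕ ↦ ((n : ℤ) - k).toNat) atTop atTop :=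
    tendsto_atTop_mono (f := fun n : ℕ ↦ n - k.natAbs) (fun n ↦ by omega)
      (tendsto_sub_atTop_nat _)
  have h := (hlim.comp h0).div ((hlim.comp h1).mul (hlim.comp h2)) (mul_ne_zero hne hne)
  rw [div_mul_cancel_left₀ hne] at h
  refine h.congr' ?_
  filter_upwards [eventually_ge_atTop k.natAbs] with n hn
  have : k ∈ Icc (-n : ℤ) n := by rw [mem_Icc]; omega
  simp only [centralCoeff, if_pos this, Pi.div_apply, Function.comp_apply]

lemma exists_norm_centralCoeff_le {q : ℂ} (hq : ‖q‖ < 1) :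
    ∃ C : ℝ, ∀ n k, ‖centralCoeff q n k‖ ≤ C := by
  have hlim : Tendsto (qfac q) atTop (𝓝 (qpoch q q)) := tendsto_prod_qpoch hq q
  obtain ⟨A, hA⟩ := hlim.norm.bddAbove_range
  obtain ⟨B, hB⟩ := (hlim.inv₀ (qpoch_self_ne_zero hq)).norm.bddAbove_range
  replace hA : ∀ n, ‖qfac q n‖ ≤ A := fun n ↦ hA ⟨n, rfl⟩
  replace hB : ∀ n, ‖(qfac q n)⁻¹‖ ≤ B := fun n ↦ hB ⟨n, rfl⟩
  have hA0 : 0 ≤ A := (norm_nonneg _).trans (hA 0)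
  have hB0 : 0 ≤ B := (norm_nonneg _).trans (hB 0)
  refine ⟨A * (B * B), fun n k ↦ ?_⟩
  unfold centralCoeff
  split_ifs
  · rw [div_eq_mul_inv, mul_inv, norm_mul, norm_mul]
    gcongr <;> first | exact hA _ | exact hB _
  · rw [norm_zero]
    positivity

lemma prod_mul_zpow_eq {q w : ℂ} (hq : q ≠ 0) (hw : w ≠ 0) (n : ℕ) :
    ∏ i ∈ range (2 * n), (1 + w * q ^ (1 - 2 * n : ℤ) * q ^ (2 * i + 1)) =
      q ^ (-(n * (n - 1)) : ℤ) * w ^ n *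
        ((∏ i ∈ range n, (1 - -(w * q ^ 2) * (q ^ 2) ^ i)) *
          ∏ i ∈ range n, (1 - -w⁻¹ * (q ^ 2) ^ i)) := by
  have hsplit : ∀ i : ℕ, w * q ^ (1 - 2 * n : ℤ) * q ^ (2 * (n + i) + 1) =
      w * q ^ 2 * (q ^ 2) ^ i := fun i ↦ by
    simp only [← zpow_natCast, mul_assoc, ← zpow_add₀ hq, ← zpow_mul]
    congr 2
    push_cast
    ring
  have hfirst : ∀ m : ℕ, ∏ i ∈ range m, (1 + w * q ^ (-(2 * i) : ℤ)) =
      q ^ (-(m * (m - 1)) : ℤ) * w ^ m * ∏ i ∈ range m, (1 - -w⁻¹ * (q ^ 2) ^ i) := fun m ↦ by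
    induction m with
    | zero => simp
    | succ m ih =>
      have h1 : q ^ (-((m + 1 : ℕ) * ((m + 1 : ℕ) - 1)) : ℤ) =
          q ^ (-(m * (m - 1)) : ℤ) * q ^ (-(2 * m) : ℤ) := by
        rw [← zpow_add₀ hq]
        congr 1
        push_cast
        ring
      have h2 : q ^ (-(2 * m) : ℤ) * (q ^ 2) ^ m = 1 := by
        rw [← pow_mul, ← zpow_natCast, ← zpow_add₀ hq]
        simp
      have h3 : 1 + w * q ^ (-(2 * m) : ℤ) =
          w * q ^ (-(2 * m) : ℤ) * (1 - -w⁻¹ * (q ^ 2) ^ m) := by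
        linear_combination (-(w * w⁻¹)) * h2 - mul_inv_cancel₀ hw
      rw [prod_range_succ, prod_range_succ, ih, h1, h3]
      ring
  rw [two_mul, prod_range_add, ← prod_range_reflect,
    mul_comm (∏ i ∈ range n, (1 - -(w * q ^ 2) * _)), ← mul_assoc, ← hfirst]
  congr 1
  · refine prod_congr rfl fun i hi ↦ ?_
    rw [mem_range] at hi
    rw [mul_assoc, ← zpow_natCast, ← zpow_add₀ hq]
    congr 3
    omega
  · refine prod_congr rfl fun i _ ↦ ?_
    rw [hsplit]
    ring

/-- The finite form of the Jacobi triple product. -/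
lemma sum_centralCoeff_eq_prod {q w : ℂ} (hq : q ≠ 0) (hq1 : ‖q ^ 2‖ < 1) (hw : w ≠ 0) (n : ℕ) :
    ∑' k : ℤ, centralCoeff (q ^ 2) n k * (q ^ (k * (k + 1)) * w ^ k) =
      (∏ i ∈ range n, (1 - -(w * q ^ 2) * (q ^ 2) ^ i)) *
        ∏ i ∈ range n, (1 - -w⁻¹ * (q ^ 2) ^ i) := by
  have hc : q ^ (-(n * (n - 1)) : ℤ) * w ^ n ≠ 0 :=
    mul_ne_zero (zpow_ne_zero _ hq) (pow_ne_zero _ hw)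
  apply mul_left_cancel₀ hc
  rw [← prod_mul_zpow_eq hq hw, prod_one_add_mul_pow_eq_sum_gaussBinom,
    tsum_eq_sum (s := Icc (-n : ℤ) n) fun k hk ↦ by rw [centralCoeff, if_neg hk, zero_mul], mul_sum]
  refine sum_nbij' (fun k ↦ (n + k).toNat) (fun j ↦ (j : ℤ) - n) ?_ ?_ ?_ ?_ ?_
  · intro k hk; simp only [mem_Icc, mem_range] at *; omega
  · intro k hk; simp only [mem_Icc, mem_range] at *; omega
  · intro k hk; simp only [mem_Icc] at *; omega
  · intro k hk; omega
  · intro k hk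
    have hk' := mem_Icc.mp hk
    obtain ⟨a, ha⟩ : ∃ a : ℕ, (n : ℤ) + k = a := ⟨(n + k).toNat, by omega⟩
    obtain ⟨b, hb⟩ : ∃ b : ℕ, (n : ℤ) - k = b := ⟨(n - k).toNat, by omega⟩
    have hab : 2 * n = a + b := by omega
    have hg : gaussBinom (q ^ 2) (2 * n) a = centralCoeff (q ^ 2) n k := by
      rw [centralCoeff, if_pos hk, ha, hb, Int.toNat_natCast, Int.toNat_natCast, eq_div_iff
        (mul_ne_zero (qfac_ne_zero hq1 _) (qfac_ne_zero hq1 _)), hab, gaussBinom_add_mul]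
    obtain rfl : k = a - n := by omega
    simp only [ha, Int.toNat_natCast, hg]
    rw [mul_pow, ← zpow_natCast (q ^ (1 - 2 * n : ℤ)), ← zpow_mul, ← zpow_natCast q (a ^ 2)]
    have e1 : q ^ (((a ^ 2 : ℕ) : ℤ)) * q ^ ((1 - 2 * n : ℤ) * a) =
        q ^ (-(n * (n - 1)) : ℤ) * q ^ ((a - n : ℤ) * (a - n + 1)) := by
      rw [← zpow_add₀ hq, ← zpow_add₀ hq]
      congr 1
      push_cast
      ring
    have e2 : w ^ n * w ^ (a - n : ℤ) = w ^ a := by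
      rw [← zpow_natCast, ← zpow_natCast, ← zpow_add₀ hw, add_sub_cancel]
    rw [← e2]
    linear_combination (-(centralCoeff (q ^ 2) n (a - n) * w ^ n * w ^ (a - n : ℤ))) * e1

/-- The Jacobi triple product. -/
lemma tsum_eq_qpoch_mul {q w : ℂ} (hq : q ≠ 0) (hq1 : ‖q ^ 2‖ < 1) (hw : w ≠ 0)
    (hs : Summable fun k : ℤ ↦ q ^ (k * (k + 1)) * w ^ k) :
    ∑' k : ℤ, q ^ (k * (k + 1)) * w ^ k =
      qpoch (q ^ 2) (q ^ 2) * (qpoch (-(w * q ^ 2)) (q ^ 2) * qpoch (-w⁻¹) (q ^ 2)) := by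
  obtain ⟨C, hC⟩ := exists_norm_centralCoeff_le hq1
  have hsum := tendsto_tsum_of_dominated_convergence (𝓕 := atTop)
    (f := fun (n : ℕ) (k : ℤ) ↦ centralCoeff (q ^ 2) n k * (q ^ (k * (k + 1)) * w ^ k))
    (hs.norm.mul_left C)
    (fun k ↦ (tendsto_centralCoeff hq1 k).mul_const _)
    (.of_forall fun n k ↦ by
      rw [norm_mul]
      exact mul_le_mul_of_nonneg_right (hC n k) (norm_nonneg _))
  simp only [sum_centralCoeff_eq_prod hq hq1 hw, tsum_mul_left] at hsum
  rw [← tendsto_nhds_unique hsum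
    ((tendsto_prod_qpoch hq1 _).mul (tendsto_prod_qpoch hq1 _)),
    mul_inv_cancel_left₀ (qpoch_self_ne_zero hq1)]

theorem theta2_product_formula (τ : ℂ) (hτ : 0 < τ.im) (z : ℂ) :
    theta2 z τ =
      2 * exp ((Real.pi : ℂ) * I * τ / 4) * Complex.cos z *
        qpoch (exp ((Real.pi : ℂ) * I * τ) ^ 2) (exp ((Real.pi : ℂ) * I * τ) ^ 2) *
        qpoch (-(exp ((Real.pi : ℂ) * I * τ) ^ 2 * exp (2 * z * I))) (exp ((Real.pi : ℂ) * I * τ) ^ 2) *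
        qpoch (-(exp ((Real.pi : ℂ) * I * τ) ^ 2 * exp (-(2 * z * I)))) (exp ((Real.pi : ℂ) * I * τ) ^ 2) := by
  set q := exp ((Real.pi : ℂ) * I * τ) with hqdef
  set w := exp (2 * z * I) with hwdef
  have hq : q ≠ 0 := exp_ne_zero _
  have hw : w ≠ 0 := exp_ne_zero _
  have hq1 : ‖q ^ 2‖ < 1 := by
    rw [norm_pow]
    refine pow_lt_one₀ (norm_nonneg _) ?_ two_ne_zero
    rw [hqdef, norm_exp, Real.exp_lt_one_iff]
    simpa using mul_pos Real.pi_pos hτ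
  have hterm : ∀ k : ℤ, exp ((Real.pi : ℂ) * I * τ * ((k : ℂ) * ((k : ℂ) + 1))) *
      exp ((2 * (k : ℂ) + 1) * z * I) = exp (z * I) * (q ^ (k * (k + 1)) * w ^ k) := fun k ↦ by
    rw [hqdef, hwdef, ← exp_int_mul, ← exp_int_mul, ← exp_add, ← exp_add, ← exp_add]
    congr 1
    push_cast
    ring
  have hs : Summable fun k : ℤ ↦ q ^ (k * (k + 1)) * w ^ k := by
    refine ((summable_jacobiTheta₂_term_iff (z / Real.pi + τ / 2) τ).mpr hτ).congr fun k ↦ ?_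
    rw [hqdef, hwdef, ← exp_int_mul, ← exp_int_mul, ← exp_add, jacobiTheta₂_term]
    congr 1
    have : (Real.pi : ℂ) ≠ 0 := by exact_mod_cast Real.pi_ne_zero
    push_cast
    field_simp
    ring
  have hcos : exp (z * I) * (1 - -w⁻¹) = 2 * cos z := by
    rw [two_cos, hwdef, ← exp_neg, sub_neg_eq_add, mul_add, mul_one, ← exp_add]
    congr 2
    ring
  rw [theta2, tsum_congr hterm, tsum_mul_left, tsum_eq_qpoch_mul hq hq1 hw hs,
    qpoch_eq_one_sub_mul hq1 (-w⁻¹), exp_neg, ← hwdef, neg_mul, mul_comm w⁻¹, mul_comm w]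
  linear_combination (exp ((Real.pi : ℂ) * I * τ / 4) * qpoch (q ^ 2) (q ^ 2) *
    qpoch (-(q ^ 2 * w)) (q ^ 2) * qpoch (-(q ^ 2 * w⁻¹)) (q ^ 2)) * hcos
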